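/- Let U = (U_i)_{i≥0} be a positional numeration system satisfying lim_{i→∞}(U_{i+1} − U_i) = +∞, and let X ⊆ ℕ be an ultimately periodic U-recognizable set with minimal period p_X. If c is a divisor of p_X such that the residue 1 occurs infinitely many times in the sequence (U_i mod c)_{i≥0}, then every deterministic finite automaton over A_U whose accepted language is rep_U(X) has at least c states. -/

import Mathlib

open Filter

/-- `C_U = sup_{i ≥ 0} ⌈U_{i+1} / U_i⌉` (with the ceiling of the quotient of
naturals written as `(U (i+1) + U i - 1) / U i`). -/
noncomputable def CU (U : ℕ → ℕ) : ℕ :=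
  sSup {c : ℕ | ∃ i, c = (U (i + 1) + U i - 1) / U i}

/-- The `U`-numerical value of the word `w = w_ℓ ⋯ w_0` (most significant digit
first): `val_U(w) = Σ_{i=0}^{ℓ} w_i U_i`. -/
def valU (U : ℕ → ℕ) (w : List ℕ) : ℕ :=
  ∑ i ∈ Finset.range w.length, w.reverse.getD i 0 * U i

/-- `w` is the greedy `U`-representation of `n` (most significant digit first):
its digits lie in `A_U = {0, …, C_U - 1}`, its leading digit is nonzero, its
`U`-numerical value is `n`, and `Σ_{i=0}^{t} w_i U_i < U_{t+1}` for all
`t = 0, …, ℓ`.  In particular `IsGreedyRep U 0 []`. -/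
def IsGreedyRep (U : ℕ → ℕ) (n : ℕ) (w : List ℕ) : Prop :=
  valU U w = n ∧
  (∀ d ∈ w, d < CU U) ∧
  (∀ h : w ≠ [], w.head h ≠ 0) ∧
  ∀ t < w.length, ∑ i ∈ Finset.range (t + 1), w.reverse.getD i 0 * U i < U (t + 1)

/-- The language `rep_U(X)` of greedy `U`-representations of the elements of `X`. -/
def repLang (U : ℕ → ℕ) (X : Set ℕ) : Language ℕ :=
  {w | ∃ n ∈ X, IsGreedyRep U n w}

/-- `X` is periodic with period `p` from index `a` on. -/
def IsPeriodPair (X : Set ℕ) (a p : ℕ) : Prop :=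
  0 < p ∧ ∀ n, a ≤ n → (n ∈ X ↔ n + p ∈ X)

/-- `X` is ultimately periodic. -/
def UltPeriodic (X : Set ℕ) : Prop := ∃ a p, IsPeriodPair X a p

/-- The minimal period `p_X` of an ultimately periodic set. -/
noncomputable def minPeriod (X : Set ℕ) : ℕ := sInf {p | ∃ a, IsPeriodPair X a p}

/-- The minimal preperiod `a_X` of an ultimately periodic set. -/
noncomputable def minPreperiod (X : Set ℕ) : ℕ :=
  sInf {a | IsPeriodPair X a (minPeriod X)}

/-- `N_U(m)`: the number of residues mod `m` taken infinitely often by the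
sequence `(U_i mod m)_{i ≥ 0}`. -/
noncomputable def Ninf (s : ℕ → ℕ) (m : ℕ) : ℕ :=
  Set.ncard {r : ZMod m | ∀ N : ℕ, ∃ i, N ≤ i ∧ (s i : ZMod m) = r}

/-- The greedy condition on all suffixes of a word. -/
def GreedyCond (U : ℕ → ℕ) (w : List ℕ) : Prop :=
  ∀ t < w.length, ∑ i ∈ Finset.range (t + 1), w.reverse.getD i 0 * U i < U (t + 1)

theorem sum_cons_eq (U : ℕ → ℕ) (d : ℕ) (w : List ℕ) (s : ℕ) (hs : s ≤ w.length) :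
    ∑ i ∈ Finset.range s, (d :: w).reverse.getD i 0 * U i
      = ∑ i ∈ Finset.range s, w.reverse.getD i 0 * U i := by
  refine Finset.sum_congr rfl fun i hi => ?_
  have hi' : i < w.reverse.length := by
    have := Finset.mem_range.1 hi
    simp; omega
  rw [List.reverse_cons, List.getD_append _ _ _ _ hi']

theorem valU_cons (U : ℕ → ℕ) (d : ℕ) (w : List ℕ) :
    valU U (d :: w) = d * U w.length + valU U w := by
  unfold valU
  rw [List.length_cons, Finset.sum_range_succ, sum_cons_eq U d w _ le_rfl, List.reverse_cons,
    List.getD_append_right _ _ _ _ (by simp)]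
  simp [add_comm]

theorem GreedyCond.cons {U : ℕ → ℕ} {d : ℕ} {w : List ℕ} (h : GreedyCond U w)
    (hv : valU U (d :: w) < U (w.length + 1)) : GreedyCond U (d :: w) := by
  intro t ht
  rw [List.length_cons] at ht
  rcases Nat.lt_succ_iff_lt_or_eq.1 ht with h1 | h1
  · rw [sum_cons_eq U d w _ h1]
    exact h t h1
  · subst h1
    exact hv

theorem GreedyCond.val_lt {U : ℕ → ℕ} (h0 : U 0 = 1) {w : List ℕ} (h : GreedyCond U w) :
    valU U w < U w.length := by
  rcases Nat.eq_zero_or_pos w.length with h1 | h1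
  · unfold valU
    rw [h1]; simp [h0]
  · have := h (w.length - 1) (by omega)
    rw [Nat.sub_add_cancel h1] at this
    exact this

theorem GreedyCond.zeros {U : ℕ → ℕ} (hmono : StrictMono U) (h0 : U 0 = 1) {w : List ℕ}
    (h : GreedyCond U w) (j : ℕ) :
    GreedyCond U (List.replicate j 0 ++ w) ∧ valU U (List.replicate j 0 ++ w) = valU U w := by
  induction j with
  | zero => simpa using h
  | succ j ih =>
    rw [List.replicate_succ, List.cons_append]
    have hv : valU U (0 :: (List.replicate j 0 ++ w)) = valU U w := by
      rw [valU_cons, ih.2]; simp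
    refine ⟨ih.1.cons ?_, hv⟩
    rw [valU_cons, zero_mul, zero_add]
    exact (ih.1.val_lt h0).trans (hmono (Nat.lt_succ_self _))

theorem exists_padded {U : ℕ → ℕ} (hmono : StrictMono U) (h0 : U 0 = 1) (l : ℕ) :
    ∀ n < U l, ∃ w : List ℕ, w.length = l ∧ GreedyCond U w ∧ valU U w = n := by
  induction l with
  | zero =>
    intro n hn
    refine ⟨[], rfl, fun t ht => absurd ht (by simp), ?_⟩
    simp [valU]; omega
  | succ l ih =>
    intro n hn
    have hpos : 0 < U l := by
      have := hmono.monotone (Nat.zero_le l); omega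
    obtain ⟨w, hl, hg, hv⟩ := ih (n % U l) (Nat.mod_lt _ hpos)
    have hval : valU U (n / U l :: w) = n := by
      rw [valU_cons, hl, hv, Nat.div_add_mod']
    refine ⟨n / U l :: w, by simp [hl], hg.cons ?_, hval⟩
    rw [hval, hl]; exact hn

theorem GreedyCond.digits {U : ℕ → ℕ} (hmono : StrictMono U) (h0 : U 0 = 1)
    (hfin : ∃ C, ∀ i, U (i + 1) ≤ C * U i) {w : List ℕ} (h : GreedyCond U w) :
    ∀ d ∈ w, d < CU U := by
  intro d hd
  obtain ⟨C, hC⟩ := hfin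
  have hpos : ∀ i, 0 < U i := fun i => by
    have := hmono.monotone (Nat.zero_le i); omega
  have hbdd : BddAbove {c : ℕ | ∃ i, c = (U (i + 1) + U i - 1) / U i} := by
    refine ⟨C + 1, ?_⟩
    rintro _ ⟨i, rfl⟩
    apply Nat.div_le_of_le_mul
    have := hC i
    have h2 : U i * (C + 1) = C * U i + U i := by ring
    omega
  obtain ⟨t, ht, hdt⟩ := List.getElem_of_mem (List.mem_reverse.2 hd)
  have ht' : t < w.length := by simpa using ht
  have h1 := h t ht'
  have h2 : w.reverse.getD t 0 * U t ≤
      ∑ i ∈ Finset.range (t + 1), w.reverse.getD i 0 * U i :=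
    Finset.single_le_sum (f := fun i => w.reverse.getD i 0 * U i)
      (fun _ _ => Nat.zero_le _) (Finset.mem_range.2 (Nat.lt_succ_self t))
  rw [List.getD_eq_getElem _ _ ht, hdt] at h2
  have h3 : d + 1 ≤ (U (t + 1) + U t - 1) / U t := by
    rw [Nat.le_div_iff_mul_le (hpos t)]
    have : (d + 1) * U t = d * U t + U t := by ring
    have := hpos t
    omega
  exact h3.trans (le_csSup hbdd ⟨t, rfl⟩)

theorem mem_repLang_iff {U : ℕ → ℕ} (hmono : StrictMono U) (h0 : U 0 = 1)
    (hfin : ∃ C, ∀ i, U (i + 1) ≤ C * U i) (X : Set ℕ) {v : List ℕ}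
    (h : GreedyCond U (1 :: v)) : 1 :: v ∈ repLang U X ↔ valU U (1 :: v) ∈ X := by
  constructor
  · rintro ⟨n, hn, hr, -⟩
    rw [hr]; exact hn
  · intro hx
    exact ⟨_, hx, rfl, h.digits hmono h0 hfin, fun _ => by simp, h⟩

theorem prefix_step {U : ℕ → ℕ} (hmono : StrictMono U) (h0 : U 0 = 1)
    (hlim : Tendsto (fun i => U (i + 1) - U i) atTop atTop)
    (p r a l : ℕ) (hr : ∀ N : ℕ, ∃ i, N ≤ i ∧ U i % p = r % p) (k : ℕ)
    (v : List ℕ) (N : ℕ) (hN : N ≡ k * r [MOD p])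
    (hv : ∀ w : List ℕ, w.length = l → GreedyCond U w →
      GreedyCond U (v ++ w) ∧ valU U (v ++ w) = N + valU U w) :
    ∃ (v' : List ℕ) (N' : ℕ), a ≤ N' ∧ N' ≡ (k + 1) * r [MOD p] ∧
      ∀ w : List ℕ, w.length = l → GreedyCond U w →
      GreedyCond U (1 :: v' ++ w) ∧ valU U (1 :: v' ++ w) = N' + valU U w := by
  obtain ⟨B, hB⟩ := (tendsto_atTop.1 hlim (N + U l)).exists_forall_of_atTop
  obtain ⟨i, hi, hir⟩ := hr (B + (v.length + l) + a)
  have hgap := hB i (by omega)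
  refine ⟨List.replicate (i - (v.length + l)) 0 ++ v, U i + N, ?_, ?_, ?_⟩
  · have := hmono.id_le i
    simp only [id] at this
    omega
  · have h1 : U i ≡ r [MOD p] := hir
    have := h1.add hN
    have e : (k + 1) * r = r + k * r := by ring
    rw [e]; exact this
  · intro w hl hg
    obtain ⟨g1, e1⟩ := hv w hl hg
    obtain ⟨g2, e2⟩ := g1.zeros hmono h0 (i - (v.length + l))
    have hlt := hg.val_lt h0
    rw [hl] at hlt
    have hlen : (List.replicate (i - (v.length + l)) 0 ++ (v ++ w)).length = i := by
      simp [hl]; omega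
    have hval : valU U (1 :: (List.replicate (i - (v.length + l)) 0 ++ (v ++ w)))
        = U i + N + valU U w := by
      rw [valU_cons, hlen, e2, e1]; ring
    rw [List.cons_append, List.append_assoc]
    refine ⟨g2.cons ?_, hval⟩
    rw [hval, hlen]
    omega

theorem exists_prefix {U : ℕ → ℕ} (hmono : StrictMono U) (h0 : U 0 = 1)
    (hlim : Tendsto (fun i => U (i + 1) - U i) atTop atTop)
    (p r a l : ℕ) (hr : ∀ N : ℕ, ∃ i, N ≤ i ∧ U i % p = r % p) (k : ℕ) :
    ∃ (v' : List ℕ) (N' : ℕ), a ≤ N' ∧ N' ≡ (k + 1) * r [MOD p] ∧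
      ∀ w : List ℕ, w.length = l → GreedyCond U w →
      GreedyCond U (1 :: v' ++ w) ∧ valU U (1 :: v' ++ w) = N' + valU U w := by
  induction k with
  | zero =>
    exact prefix_step hmono h0 hlim p r a l hr 0 [] 0 (by simp; rfl)
      (fun w _ hg => by simpa using hg)
  | succ k ih =>
    obtain ⟨v, N, -, hN, hv⟩ := ih
    exact prefix_step hmono h0 hlim p r a l hr (k + 1) (1 :: v) N hN hv

theorem period_modEq {X : Set ℕ} {a p : ℕ} (h : IsPeriodPair X a p) {x y : ℕ}
    (hx : a ≤ x) (hy : a ≤ y) (hxy : x ≡ y [MOD p]) : x ∈ X ↔ y ∈ X := by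
  have key : ∀ j x, a ≤ x → (x ∈ X ↔ x + p * j ∈ X) := by
    intro j
    induction j with
    | zero => intro x _; simp
    | succ j ih =>
      intro x hx
      rw [ih x hx, h.2 (x + p * j) (by omega), Nat.mul_succ, add_assoc]
  rcases le_total x y with hle | hle
  · obtain ⟨j, hj⟩ := (Nat.modEq_iff_dvd' hle).1 hxy
    rw [key j x hx, ← hj, Nat.add_sub_cancel' hle]
  · obtain ⟨j, hj⟩ := (Nat.modEq_iff_dvd' hle).1 hxy.symm
    rw [key j y hy, ← hj, Nat.add_sub_cancel' hle]

/-- Let `U` be a positional numeration system with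
`lim_{i→∞} (U_{i+1} - U_i) = +∞`, and let `X ⊆ ℕ` be an ultimately periodic
`U`-recognizable set with minimal period `p_X`.  If `c` divides `p_X` and the
residue `1` occurs infinitely many times in `(U_i mod c)_{i ≥ 0}`, then every
deterministic finite automaton over `A_U` accepting `rep_U(X)` has at least `c`
states. -/
theorem statement_4 (U : ℕ → ℕ) (hmono : StrictMono U) (h0 : U 0 = 1)
    (hfin : ∃ C, ∀ i, U (i + 1) ≤ C * U i)
    (hlim : Tendsto (fun i => U (i + 1) - U i) atTop atTop)
    (X : Set ℕ) (hX : UltPeriodic X)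
    (c : ℕ) (hc : c ∣ minPeriod X)
    (hone : ∀ N : ℕ, ∃ i, N ≤ i ∧ U i % c = 1)
    (σ : Type*) [Fintype σ] (M : DFA ℕ σ) (hM : M.accepts = repLang U X) :
    c ≤ Fintype.card σ := by
  obtain ⟨a0, p0, hp0⟩ := hX
  obtain ⟨a, ha⟩ : ∃ a, IsPeriodPair X a (minPeriod X) :=
    Nat.sInf_mem (s := {p | ∃ a, IsPeriodPair X a p}) ⟨p0, a0, hp0⟩
  have hmin : ∀ q, (∃ a, IsPeriodPair X a q) → minPeriod X ≤ q := fun q hq => Nat.sInf_le hq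
  generalize minPeriod X = p at *
  have hp := ha.1
  obtain ⟨r, hrc, hr⟩ : ∃ r, r % c = 1 ∧ ∀ N : ℕ, ∃ i, N ≤ i ∧ U i % p = r % p := by
    by_contra hcon
    push Not at hcon
    choose! f hf using hcon
    obtain ⟨i, hi, hi1⟩ := hone (∑ r ∈ Finset.range p, f r)
    have h1 : U i % p % c = 1 := by rw [Nat.mod_mod_of_dvd _ hc]; exact hi1
    have hle : f (U i % p) ≤ ∑ r ∈ Finset.range p, f r :=
      Finset.single_le_sum (fun _ _ => Nat.zero_le _) (Finset.mem_range.2 (Nat.mod_lt _ hp))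
    exact hf _ h1 i (hle.trans hi) (Nat.mod_mod _ _).symm
  have hpl : p ≤ U p := hmono.id_le p
  choose v N haN hN hv using exists_prefix hmono h0 hlim p r a p hr
  have main : ∀ k k', k < k' → k' < c → M.eval (1 :: v k) ≠ M.eval (1 :: v k') := by
    intro k k' hkk hkc heq
    have hmem : ∀ n < p, (N k + n ∈ X ↔ N k' + n ∈ X) := by
      intro n hn
      obtain ⟨w, hl, hg, hw⟩ := exists_padded hmono h0 p n (hn.trans_le hpl)
      obtain ⟨g1, e1⟩ := hv k w hl hg
      obtain ⟨g2, e2⟩ := hv k' w hl hg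
      have m1 := mem_repLang_iff hmono h0 hfin X (v := v k ++ w) g1
      have m2 := mem_repLang_iff hmono h0 hfin X (v := v k' ++ w) g2
      rw [← List.cons_append, e1, hw, ← hM, DFA.mem_accepts] at m1
      rw [← List.cons_append, e2, hw, ← hM, DFA.mem_accepts] at m2
      rw [← m1, ← m2]
      unfold DFA.eval at heq ⊢
      rw [DFA.evalFrom_of_append, DFA.evalFrom_of_append, heq]
    obtain ⟨e, rfl⟩ := Nat.exists_eq_add_of_lt hkk
    have hNN : N (k + e + 1) ≡ N k + (e + 1) * r [MOD p] := by
      refine (hN _).trans ?_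
      have : (k + e + 1 + 1) * r = (k + 1) * r + (e + 1) * r := by ring
      rw [this]
      exact (hN k).symm.add_right _
    have hper : ∀ m, a ≤ m → (m ∈ X ↔ m + ((e + 1) * r) % p ∈ X) := by
      intro m hm
      obtain ⟨n, hn, hnm⟩ : ∃ n < p, N k + n ≡ m [MOD p] := by
        refine ⟨(m + (p - 1) * N k) % p, Nat.mod_lt _ hp, ?_⟩
        have h1 : N k + (m + (p - 1) * N k) % p ≡ N k + (m + (p - 1) * N k) [MOD p] :=
          (Nat.mod_modEq _ _).add_left _
        refine h1.trans ?_
        obtain ⟨q, rfl⟩ := Nat.exists_eq_succ_of_ne_zero hp.ne'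
        have h2 : N k + (m + (q.succ - 1) * N k) = m + q.succ * N k := by
          simp only [Nat.succ_eq_add_one, Nat.add_sub_cancel]; ring
        rw [h2]
        simp [Nat.ModEq]
      rw [← period_modEq ha ((haN k).trans (Nat.le_add_right _ n)) hm hnm, hmem n hn]
      refine period_modEq ha ((haN _).trans (Nat.le_add_right _ n)) (by omega) ?_
      have h3 := hNN.add_right n
      have h4 : N k + (e + 1) * r + n = (N k + n) + (e + 1) * r := by ring
      rw [h4] at h3
      exact h3.trans (hnm.add (Nat.mod_modEq _ _).symm)
    have hz : ((e + 1) * r) % p = 0 := by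
      by_contra hne
      have := hmin _ ⟨a, Nat.pos_of_ne_zero hne, hper⟩
      exact absurd (Nat.mod_lt ((e + 1) * r) hp) (by omega)
    have hdvd : c ∣ (e + 1) * r := hc.trans (Nat.dvd_of_mod_eq_zero hz)
    have hcop : Nat.Coprime c r := by
      unfold Nat.Coprime
      rw [Nat.gcd_rec, hrc]; simp
    have := Nat.le_of_dvd (Nat.succ_pos e) (hcop.dvd_of_dvd_mul_right hdvd)
    omega
  have hinj : Function.Injective (fun k : Fin c => M.eval (1 :: v k)) := by
    intro k k' hk
    by_contra hne
    rcases lt_or_gt_of_ne hne with h | h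
    · exact main k k' h k'.2 hk
    · exact main k' k h k.2 hk.symm
  simpa using Fintype.card_le_of_injective _ hinj
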